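/- arXiv:2108.08746 — 2 statements merged into one kernel-verified Lean document; each statement's English description precedes it below -/
import Mathlib

section
/- Fix R > 0 and ρ₀ ∈ (0,1). Let (γ_k) be a sequence in (0,1) with γ_k → 1, and let (r_k) be a sequence with r_k ∈ (0, R) and I_{0,γ_k}(r_k / ρ₀) = (1/2) · I_{0,γ_k}(R) for every k. Then r_k → 0. -/
open MeasureTheory

/-- Modified Bessel function of the second kind:
`K_ν(x) = ∫₀^∞ exp(−x cosh s) cosh(ν s) ds` (so `K_{−ν} = K_ν`). -/
noncomputable def besselK (ν x : ℝ) : ℝ :=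
  ∫ s in Set.Ioi (0 : ℝ), Real.exp (-x * Real.cosh s) * Real.cosh (ν * s)

/-- Modified Bessel function of the first kind:
`I_ν(x) = Σ_{j≥0} (x/2)^{2j+ν}/(j! Γ(ν+j+1))`. -/
noncomputable def besselI (ν x : ℝ) : ℝ :=
  ∑' j : ℕ, (x / 2) ^ (2 * (j : ℝ) + ν) / ((j.factorial : ℝ) * Real.Gamma (ν + j + 1))

/-- Normalizing constant `C(3,γ) = 2^{2γ} Γ(3/2+γ)/(π^{3/2} |Γ(−γ)|)`. -/
noncomputable def C3 (γ : ℝ) : ℝ :=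
  2 ^ (2 * γ) * Real.Gamma (3 / 2 + γ) / (Real.pi ^ ((3 : ℝ) / 2) * |Real.Gamma (-γ)|)

/-- The kernel
`K_γ(ρ) = C(3,γ) (sinh ρ)⁻¹ ρ^{−1/2−γ} · 2 K_{3/2+γ}(ρ) / (Γ(3/2+γ) 2^{3/2+γ})`. -/
noncomputable def Kker (γ ρ : ℝ) : ℝ :=
  C3 γ * (Real.sinh ρ)⁻¹ * ρ ^ (-(1 / 2 : ℝ) - γ) * (2 * besselK (3 / 2 + γ) ρ) /
    (Real.Gamma (3 / 2 + γ) * 2 ^ ((3 : ℝ) / 2 + γ))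

/-- Scale function `I_{0,γ}(R) = 4π ∫₀^R ρ² K_γ(ρ) sinh²ρ dρ`. -/
noncomputable def scaleI0 (γ R : ℝ) : ℝ :=
  4 * Real.pi * ∫ ρ in (0 : ℝ)..R, ρ ^ 2 * Kker γ ρ * (Real.sinh ρ) ^ 2

/-- Scale function `I_{∞,γ}(R) = 4π R² ∫_R^∞ K_γ(ρ) sinh²ρ dρ`. -/
noncomputable def scaleIinf (γ R : ℝ) : ℝ :=
  4 * Real.pi * R ^ 2 * ∫ ρ in Set.Ioi R, Kker γ ρ * (Real.sinh ρ) ^ 2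


lemma aux_pt (p ν x s : ℝ) (hp : 0 < p) (hν : 0 ≤ ν) (hx : 0 < x) (hs : 0 ≤ s) :
    Real.exp (-x * Real.cosh s) * Real.cosh (ν * s) ≤
      (x / (2 * p)) ^ (-p) * Real.exp (-(p - ν) * s) := by
  have h1 : Real.cosh (ν * s) ≤ Real.exp (ν * s) := by
    rw [Real.cosh_eq]
    have : Real.exp (-(ν * s)) ≤ Real.exp (ν * s) :=
      Real.exp_le_exp.mpr (by nlinarith [mul_nonneg hν hs])
    linarith
  have h2 : Real.exp (-x * Real.cosh s) ≤ (x / (2 * p)) ^ (-p) * Real.exp (-p * s) := by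
    have h3 : x / (2 * p) * Real.exp s ≤ Real.exp (x * Real.cosh s / p) := by
      have a1 : x / (2 * p) * Real.exp s ≤ x * Real.cosh s / p := by
        rw [Real.cosh_eq]
        have : x * ((Real.exp s + Real.exp (-s)) / 2) / p =
          x / (2 * p) * Real.exp s + x / (2 * p) * Real.exp (-s) := by field_simp
        rw [this]
        have : 0 ≤ x / (2 * p) * Real.exp (-s) := by positivity
        linarith
      have a2 := Real.add_one_le_exp (x * Real.cosh s / p)
      linarith
    have h4 : (Real.exp (x * Real.cosh s / p)) ^ (-p) ≤ (x / (2 * p) * Real.exp s) ^ (-p) :=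
      Real.rpow_le_rpow_of_nonpos (by positivity) h3 (by linarith)
    rw [Real.mul_rpow (by positivity) (by positivity), ← Real.exp_mul, ← Real.exp_mul] at h4
    have e1 : x * Real.cosh s / p * -p = -x * Real.cosh s := by field_simp
    have e2 : s * -p = -p * s := by ring
    rwa [e1, e2] at h4
  calc _ ≤ ((x / (2 * p)) ^ (-p) * Real.exp (-p * s)) * Real.exp (ν * s) := by
        gcongr

    _ = _ := by rw [mul_assoc, ← Real.exp_add]; ring_nf

lemma aux_exp_int (p ν : ℝ) (h : ν < p) :
    IntegrableOn (fun s => Real.exp (-(p - ν) * s)) (Set.Ioi 0) :=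
  integrableOn_exp_mul_Ioi (by linarith) 0

lemma aux_K_int (p ν x : ℝ) (hν : 0 ≤ ν) (h : ν < p) (hx : 0 < x) :
    IntegrableOn (fun s => Real.exp (-x * Real.cosh s) * Real.cosh (ν * s)) (Set.Ioi 0) := by
  refine Integrable.mono' ((aux_exp_int p ν h).const_mul ((x / (2 * p)) ^ (-p))) ?_ ?_
  · exact Continuous.aestronglyMeasurable (by fun_prop)
  · filter_upwards [ae_restrict_mem measurableSet_Ioi] with s hs
    rw [Real.norm_of_nonneg (by positivity)]
    exact aux_pt p ν x s (by linarith) hν hx (le_of_lt hs)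

lemma aux_K_le (p ν x : ℝ) (hν : 0 ≤ ν) (h : ν < p) (hx : 0 < x) :
    besselK ν x ≤ (x / (2 * p)) ^ (-p) / (p - ν) := by
  unfold besselK
  calc _ ≤ ∫ s in Set.Ioi (0:ℝ), (x / (2 * p)) ^ (-p) * Real.exp (-(p - ν) * s) := by
        apply setIntegral_mono_on (aux_K_int p ν x hν h hx)
          ((aux_exp_int p ν h).const_mul _) measurableSet_Ioi
        intro s hs
        exact aux_pt p ν x s (by linarith) hν hx (le_of_lt hs)
    _ = _ := by
        rw [integral_const_mul, integral_exp_mul_Ioi (by linarith)]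
        rw [mul_zero, Real.exp_zero, neg_div_neg_eq, mul_one_div]

lemma aux_K_nonneg (ν x : ℝ) : 0 ≤ besselK ν x := by
  unfold besselK
  apply integral_nonneg
  intro s
  dsimp only
  positivity

lemma aux_K_ge (ν x : ℝ) (hν : 0 ≤ ν) (hx : 0 < x) (hx1 : x ≤ 1) :
    Real.exp (-Real.exp 1) / 2 * x ^ (-ν) ≤ besselK ν x := by
  unfold besselK
  have hl : 0 ≤ -Real.log x := by
    have := Real.log_nonpos hx.le hx1
    linarith
  calc Real.exp (-Real.exp 1) / 2 * x ^ (-ν)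
      = ∫ s in Set.Ioc (-Real.log x) (-Real.log x + 1), Real.exp (-Real.exp 1) / 2 * x ^ (-ν) := by
        simp
    _ ≤ ∫ s in Set.Ioc (-Real.log x) (-Real.log x + 1),
          Real.exp (-x * Real.cosh s) * Real.cosh (ν * s) := by
        apply setIntegral_mono_on _ _ measurableSet_Ioc
        · intro s hs
          have hs0 : 0 ≤ s := by linarith [hs.1]
          have h1 : Real.exp (-Real.exp 1) ≤ Real.exp (-x * Real.cosh s) := by
            apply Real.exp_le_exp.mpr
            have : Real.cosh s ≤ Real.exp s := by
              rw [Real.cosh_eq]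
              have : Real.exp (-s) ≤ Real.exp s := Real.exp_le_exp.mpr (by linarith)
              linarith
            have h2 : x * Real.exp s ≤ Real.exp 1 := by
              nth_rewrite 1 [← Real.exp_log hx]
              rw [← Real.exp_add]
              exact Real.exp_le_exp.mpr (by linarith [hs.2])
            nlinarith
          have h2 : x ^ (-ν) / 2 ≤ Real.cosh (ν * s) := by
            rw [Real.cosh_eq, Real.rpow_def_of_pos hx]
            have : Real.exp (Real.log x * -ν) ≤ Real.exp (ν * s) :=
              Real.exp_le_exp.mpr (by nlinarith [hs.1])
            have := Real.exp_pos (-(ν * s))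
            linarith
          calc _ = Real.exp (-Real.exp 1) * (x ^ (-ν) / 2) := by ring
            _ ≤ _ := by gcongr
        · exact integrableOn_const (by simp)
        · exact (Continuous.integrableOn_Icc (by fun_prop)).mono_set Set.Ioc_subset_Icc_self
    _ ≤ _ := by
        apply setIntegral_mono_set (aux_K_int (ν + 1) ν x hν (by linarith) hx)
        · filter_upwards with s
          simp only [Pi.zero_apply]
          positivity
        · apply LE.le.eventuallyLE
          intro s hs
          exact lt_of_le_of_lt hl hs.1

lemma aux_K_meas (ν : ℝ) : Measurable (besselK ν) := by
  have : StronglyMeasurable (fun x : ℝ => ∫ s, Real.exp (-x * Real.cosh s) * Real.cosh (ν * s)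
      ∂(volume.restrict (Set.Ioi (0:ℝ)))) := by
    apply StronglyMeasurable.integral_prod_right
      (f := fun x s : ℝ => Real.exp (-x * Real.cosh s) * Real.cosh (ν * s))
    apply Continuous.stronglyMeasurable
    simp only [Function.uncurry_def]
    fun_prop
  exact this.measurable

noncomputable def auxG (γ ρ : ℝ) : ℝ := ρ ^ (3 / 2 - γ) * Real.sinh ρ * besselK (3 / 2 + γ) ρ

lemma auxG_meas (γ : ℝ) : Measurable (auxG γ) := by
  unfold auxG
  have := aux_K_meas (3 / 2 + γ)
  have h2 : Measurable Real.sinh := Real.continuous_sinh.measurable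
  fun_prop

lemma auxG_nonneg (γ ρ : ℝ) (h : 0 ≤ ρ) : 0 ≤ auxG γ ρ := by
  unfold auxG
  have := aux_K_nonneg (3 / 2 + γ) ρ
  have := Real.sinh_nonneg_iff.mpr h
  positivity

lemma aux_sinh_le (ρ : ℝ) (h : 0 ≤ ρ) : Real.sinh ρ ≤ ρ * Real.cosh ρ := by
  have hm : MonotoneOn (fun x => x * Real.cosh x - Real.sinh x) (Set.Ici 0) := by
    apply monotoneOn_of_deriv_nonneg (convex_Ici 0)
    · fun_prop
    · fun_prop
    · intro x hx
      simp only [interior_Ici, Set.mem_Ioi] at hx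
      have : HasDerivAt (fun x => x * Real.cosh x - Real.sinh x)
        (1 * Real.cosh x + x * Real.sinh x - Real.cosh x) x :=
        ((hasDerivAt_id x).mul (Real.hasDerivAt_cosh x)).sub (Real.hasDerivAt_sinh x)
      rw [this.deriv]
      have := Real.sinh_nonneg_iff.mpr hx.le
      nlinarith
  have := hm (Set.mem_Ici.mpr le_rfl) (Set.mem_Ici.mpr h) h
  simp at this
  linarith

lemma auxG_int (γ T : ℝ) (h0 : 0 < γ) (h1 : γ < 1) (hT : 0 ≤ T) :
    IntervalIntegrable (auxG γ) volume 0 T := by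
  have hi : IntervalIntegrable (fun ρ : ℝ =>
      (Real.cosh T * ((1 / 5 : ℝ) ^ (-(5/2) : ℝ) / (1 - γ))) * ρ ^ (-γ))
      volume 0 T :=
    (intervalIntegral.intervalIntegrable_rpow' (r := -γ) (by linarith)).const_mul _
  refine hi.mono_fun' (auxG_meas γ).aestronglyMeasurable ?_
  rw [Set.uIoc_of_le hT]
  filter_upwards [ae_restrict_mem measurableSet_Ioc] with ρ hρ
  have hp : 0 < ρ := hρ.1
  rw [Real.norm_of_nonneg (auxG_nonneg γ ρ hp.le)]
  unfold auxG
  have hK := aux_K_le (5/2) (3/2+γ) ρ (by linarith) (by linarith) hp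
  have e : ρ / (2 * (5 / 2)) = ρ * (1/5) := by ring
  rw [e, Real.mul_rpow hp.le (by norm_num)] at hK
  have hs : Real.sinh ρ ≤ ρ * Real.cosh T := by
    refine (aux_sinh_le ρ hp.le).trans ?_
    have : Real.cosh ρ ≤ Real.cosh T := by
      rw [Real.cosh_le_cosh, abs_of_pos hp, abs_of_nonneg hT]; exact hρ.2
    gcongr
  have hs0 := Real.sinh_nonneg_iff.mpr hp.le
  have hg : 0 < 1 - γ := by linarith
  calc _ ≤ ρ ^ (3 / 2 - γ) * (ρ * Real.cosh T) *
        (ρ ^ (-(5/2) : ℝ) * (1 / 5) ^ (-(5/2) : ℝ) / (5/2 - (3/2+γ))) := by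
        gcongr
        exact aux_K_nonneg _ _
    _ = (ρ ^ (3 / 2 - γ) * ρ ^ (1:ℝ) * ρ ^ (-(5/2) : ℝ)) *
        (Real.cosh T * ((1 / 5 : ℝ) ^ (-(5/2) : ℝ) / (1 - γ))) := by
        rw [Real.rpow_one]
        have : (5/2 - (3/2+γ)) = 1 - γ := by ring
        rw [this]; ring
    _ = _ := by
        rw [← Real.rpow_add hp, ← Real.rpow_add hp, mul_comm]
        congr 2
        ring

lemma auxG_lower (γ b : ℝ) (h0 : 0 < γ) (h1 : γ < 1) (hb : 0 < b) (hb1 : b ≤ 1) :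
    Real.exp (-Real.exp 1) / 2 * (b ^ 2 / (2 - 2 * γ)) ≤ ∫ ρ in (0:ℝ)..b, auxG γ ρ := by
  calc _ ≤ Real.exp (-Real.exp 1) / 2 * (b ^ (2 - 2 * γ) / (2 - 2 * γ)) := by
        have : b ^ 2 ≤ b ^ (2 - 2 * γ) := by
          rw [← Real.rpow_natCast]
          apply Real.rpow_le_rpow_of_exponent_ge hb hb1
          push_cast; linarith
        have : 0 < 2 - 2 * γ := by linarith
        gcongr
    _ = ∫ ρ in (0:ℝ)..b, Real.exp (-Real.exp 1) / 2 * ρ ^ (1 - 2 * γ) := by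
        rw [intervalIntegral.integral_const_mul, integral_rpow (Or.inl (by linarith))]
        have : 1 - 2 * γ + 1 = 2 - 2 * γ := by ring
        rw [this, Real.zero_rpow (by linarith)]
        simp
    _ ≤ _ := by
        apply intervalIntegral.integral_mono_on_of_le_Ioo hb.le
          ((intervalIntegral.intervalIntegrable_rpow' (r := 1 - 2 * γ) (by linarith)).const_mul _)
          (auxG_int γ b h0 h1 hb.le)
        intro ρ hρ
        have hp : 0 < ρ := hρ.1
        have hK := aux_K_ge (3/2+γ) ρ (by linarith) hp (by linarith [hρ.2])
        have hs : ρ ≤ Real.sinh ρ := Real.self_le_sinh_iff.mpr hp.le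
        unfold auxG
        calc _ = Real.exp (-Real.exp 1) / 2 *
                (ρ ^ (3 / 2 - γ) * ρ ^ (1:ℝ) * ρ ^ (-(3/2+γ))) := by
              rw [← Real.rpow_add hp, ← Real.rpow_add hp]
              congr 2
              ring
          _ = ρ ^ (3 / 2 - γ) * ρ * (Real.exp (-Real.exp 1) / 2 * ρ ^ (-(3/2+γ))) := by
              rw [Real.rpow_one]; ring
          _ ≤ _ := by gcongr

lemma auxG_upper (γ a R : ℝ) (h0 : 0 < γ) (h1 : γ < 1) (ha : 0 < a) (haR : a ≤ R) :
    ∫ ρ in a..R, auxG γ ρ ≤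
      (R - a) * ((1 + R) ^ (3/2 : ℝ) * Real.sinh R * (a / 7) ^ (-(7/2) : ℝ)) := by
  have hR : 0 < R := by linarith
  rw [← smul_eq_mul, ← intervalIntegral.integral_const]
  apply intervalIntegral.integral_mono_on haR
  · exact ((auxG_int γ a h0 h1 ha.le).symm).trans (auxG_int γ R h0 h1 hR.le)
  · exact intervalIntegrable_const
  intro ρ hρ
  have hp : 0 < ρ := by linarith [hρ.1]
  have hK := aux_K_le (7/2) (3/2+γ) ρ (by linarith) (by linarith) hp
  have e : ρ / (2 * (7 / 2)) = ρ / 7 := by ring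
  rw [e] at hK
  have hK2 : besselK (3/2+γ) ρ ≤ (a / 7) ^ (-(7/2) : ℝ) := by
    refine hK.trans ?_
    have : (ρ / 7) ^ (-(7/2) : ℝ) ≤ (a / 7) ^ (-(7/2) : ℝ) :=
      Real.rpow_le_rpow_of_nonpos (by positivity) (by linarith [hρ.1]) (by norm_num)
    refine le_trans ?_ this
    apply div_le_self (by positivity) (by linarith)
  have hr : ρ ^ (3 / 2 - γ) ≤ (1 + R) ^ (3/2 : ℝ) := by
    calc _ ≤ (1 + R) ^ (3/2 - γ) :=
          Real.rpow_le_rpow hp.le (by linarith [hρ.2]) (by linarith)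
      _ ≤ _ := Real.rpow_le_rpow_of_exponent_le (by linarith) (by linarith)
  have hs : Real.sinh ρ ≤ Real.sinh R := Real.sinh_le_sinh.mpr hρ.2
  have hs0 := Real.sinh_nonneg_iff.mpr hp.le
  have hs1 := Real.sinh_nonneg_iff.mpr hR.le
  have := aux_K_nonneg (3/2+γ) ρ
  unfold auxG
  gcongr

lemma aux_scale (γ : ℝ) (h0 : 0 < γ) (h1 : γ < 1) :
    ∃ c : ℝ, 0 < c ∧ ∀ T, 0 ≤ T → scaleI0 γ T = c * ∫ ρ in (0:ℝ)..T, auxG γ ρ := by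
  have hG : 0 < Real.Gamma (3 / 2 + γ) := Real.Gamma_pos_of_pos (by linarith)
  have hG' : Real.Gamma (-γ) ≠ 0 := by
    apply Real.Gamma_ne_zero
    intro m hm
    have hm' : γ = m := by linarith
    rw [hm'] at h0 h1
    have a1 : 0 < m := by exact_mod_cast h0
    have a2 : m < 1 := by exact_mod_cast h1
    omega
  have hC : 0 < C3 γ := by
    unfold C3
    have := abs_pos.mpr hG'
    have := Real.pi_pos
    positivity
  have := Real.pi_pos
  refine ⟨4 * Real.pi * (C3 γ * 2 / (Real.Gamma (3 / 2 + γ) * 2 ^ ((3 : ℝ) / 2 + γ))),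
    by positivity, ?_⟩
  intro T hT
  unfold scaleI0
  rw [mul_assoc (4 * Real.pi)]
  congr 1
  rw [← intervalIntegral.integral_const_mul]
  apply intervalIntegral.integral_congr_ae
  filter_upwards with ρ hρ
  rw [Set.uIoc_of_le hT] at hρ
  have hp : 0 < ρ := hρ.1
  have hs : 0 < Real.sinh ρ := Real.sinh_pos_iff.mpr hp
  unfold Kker auxG
  have e : ρ ^ (3 / 2 - γ) = ρ ^ 2 * ρ ^ (-(1 / 2 : ℝ) - γ) := by
    rw [← Real.rpow_natCast, ← Real.rpow_add hp]
    congr 1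
    push_cast; ring
  rw [e]
  field_simp

/-- Lemma 5.6: if `γ_k → 1` in `(0,1)` and `r_k ∈ (0,R)` satisfy
`I_{0,γ_k}(r_k/ρ₀) = I_{0,γ_k}(R)/2`, then `r_k → 0`. -/
theorem r0_tendsto_zero (R ρ₀ : ℝ) (hR : 0 < R) (hρ₀ : ρ₀ ∈ Set.Ioo (0 : ℝ) 1)
    (γ : ℕ → ℝ) (hγ : ∀ k, γ k ∈ Set.Ioo (0 : ℝ) 1)
    (hγ1 : Filter.Tendsto γ Filter.atTop (nhds 1))
    (r : ℕ → ℝ) (hr : ∀ k, r k ∈ Set.Ioo 0 R)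
    (hI : ∀ k, scaleI0 (γ k) (r k / ρ₀) = scaleI0 (γ k) R / 2) :
    Filter.Tendsto r Filter.atTop (nhds 0) := by
  rw [Metric.tendsto_atTop']
  intro ε hε
  -- the cut-off
  set b : ℝ := min ε (min R 1) with hb
  have hb0 : 0 < b := by positivity
  have hbε : b ≤ ε := min_le_left _ _
  have hbR : b ≤ R := (min_le_right _ _).trans (min_le_left _ _)
  have hb1 : b ≤ 1 := (min_le_right _ _).trans (min_le_right _ _)
  set M : ℝ := (R - b) * ((1 + R) ^ (3/2 : ℝ) * Real.sinh R * (b / 7) ^ (-(7/2) : ℝ)) with hM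
  set q : ℝ := Real.exp (-Real.exp 1) / 2 * b ^ 2 with hq
  have hq0 : 0 < q := by positivity
  have hlim : Filter.Tendsto (fun k => M * (2 - 2 * γ k)) Filter.atTop (nhds 0) := by
    have : Filter.Tendsto (fun k => M * (2 - 2 * γ k)) Filter.atTop (nhds (M * (2 - 2 * 1))) :=
      (tendsto_const_nhds.sub (hγ1.const_mul 2)).const_mul M
    simpa using this
  obtain ⟨N, hN⟩ := Filter.eventually_atTop.mp (hlim.eventually (gt_mem_nhds hq0))
  refine ⟨N, fun k hk => ?_⟩
  have hNk := hN k hk.le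
  obtain ⟨h0, h1⟩ := hγ k
  obtain ⟨hr0, hrR⟩ := hr k
  rw [Real.dist_eq, sub_zero, abs_of_pos hr0]
  by_contra! hcon
  have hρp := hρ₀.1
  have hbr : b ≤ r k / ρ₀ := by
    rw [le_div_iff₀ hρp]
    nlinarith [hρ₀.2]
  obtain ⟨c, hc, hsc⟩ := aux_scale (γ k) h0 h1
  have h := hI k
  rw [hsc _ (by positivity), hsc _ hR.le] at h
  have h' : ∫ ρ in (0:ℝ)..(r k / ρ₀), auxG (γ k) ρ = (∫ ρ in (0:ℝ)..R, auxG (γ k) ρ) / 2 := by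
    apply mul_left_cancel₀ hc.ne'
    rw [h]; ring
  have ib := auxG_int (γ k) b h0 h1 hb0.le
  have iR := auxG_int (γ k) R h0 h1 hR.le
  have ir := auxG_int (γ k) (r k / ρ₀) h0 h1 (by positivity)
  have s1 := intervalIntegral.integral_add_adjacent_intervals ib (ib.symm.trans iR)
  have s2 := intervalIntegral.integral_add_adjacent_intervals ib (ib.symm.trans ir)
  have n2 : 0 ≤ ∫ ρ in b..(r k / ρ₀), auxG (γ k) ρ := by
    apply intervalIntegral.integral_nonneg hbr
    intro u hu
    exact auxG_nonneg _ _ (by linarith [hu.1])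
  have hu := auxG_upper (γ k) b R h0 h1 hb0 hbR
  have hl := auxG_lower (γ k) b h0 h1 hb0 hb1
  have h3 : Real.exp (-Real.exp 1) / 2 * (b ^ 2 / (2 - 2 * γ k)) ≤ M := by linarith
  have hg : 0 < 2 - 2 * γ k := by linarith
  have h4 : q ≤ M * (2 - 2 * γ k) := by
    rw [← div_le_iff₀ hg, hq, mul_div_assoc]
    exact h3
  linarith
end

section
/- Let α > 0 and R₀ > 0. Then for all t > 1/cosh R₀, ( arcosh(t · cosh R₀) )^{−2α−1} · t cosh R₀ / (t² cosh² R₀ − 1)^{3/2} − R₀^{−2α−1} · cosh R₀ / sinh³ R₀ ≥ − R₀^{−2α} · ( (2α + 1)𝓗(R₀) − R₀² + 3𝓗(R₀)² ) · 𝓗(R₀) · (t − 1) / ( R₀⁴ · sinh² R₀ ). -/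
/-- Inverse hyperbolic cosine: `arcosh x = log(x + √(x² − 1))` for `x ≥ 1`. -/
noncomputable def arcosh (x : ℝ) : ℝ := Real.log (x + Real.sqrt (x ^ 2 - 1))

/-- `𝓗(s) = s coth s`. -/
noncomputable def Hfun (s : ℝ) : ℝ := s * Real.cosh s / Real.sinh s

/-- Minus the derivative in `cosh s` of `s^{-p} cosh s / sinh³ s`. -/
noncomputable def auxD (p s : ℝ) : ℝ :=
  s ^ (-p) * (p / s * (Real.cosh s / Real.sinh s) * (1 / Real.sinh s ^ 3)
    + 2 / Real.sinh s ^ 3 + 3 / Real.sinh s ^ 5)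

noncomputable def auxF (p s : ℝ) : ℝ := s ^ (-p) * (Real.cosh s / Real.sinh s ^ 3)

lemma auxD_anti {p r s : ℝ} (hp : 0 < p) (hr : 0 < r) (hrs : r ≤ s) : auxD p s ≤ auxD p r := by
  have hs : 0 < s := hr.trans_le hrs
  have h1 : 0 < Real.sinh r := Real.sinh_pos_iff.2 hr
  have h2 : 0 < Real.sinh s := Real.sinh_pos_iff.2 hs
  have h3 : Real.sinh r ≤ Real.sinh s := Real.sinh_le_sinh.2 hrs
  have hc : 0 < Real.cosh s := Real.cosh_pos s
  have hc' : 0 < Real.cosh r := Real.cosh_pos r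
  have h4 : Real.cosh s / Real.sinh s ≤ Real.cosh r / Real.sinh r := by
    rw [div_le_div_iff₀ h2 h1]
    have := Real.sinh_nonneg_iff.2 (sub_nonneg.2 hrs)
    rw [Real.sinh_sub] at this
    linarith
  have h5 : s ^ (-p) ≤ r ^ (-p) :=
    Real.rpow_le_rpow_of_nonpos hr hrs (by linarith)
  have h6 : 0 ≤ r ^ (-p) := (Real.rpow_pos_of_pos hr _).le
  unfold auxD
  gcongr

lemma auxF_deriv {p s : ℝ} (hs : 0 < s) :
    HasDerivAt (auxF p) (-(Real.sinh s * auxD p s)) s := by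
  have h2 : Real.sinh s ≠ 0 := (Real.sinh_pos_iff.2 hs).ne'
  have h := (Real.hasDerivAt_rpow_const (x := s) (p := -p) (Or.inl hs.ne')).mul
    ((Real.hasDerivAt_cosh s).div ((Real.hasDerivAt_sinh s).pow 3) (pow_ne_zero 3 h2))
  refine HasDerivAt.congr_deriv (f := auxF p) h ?_
  simp only [auxD, Pi.pow_apply, Pi.div_apply]
  rw [Real.rpow_sub_one hs.ne']
  have hc : Real.cosh s ^ 2 = Real.sinh s ^ 2 + 1 := Real.cosh_sq s
  field_simp
  push_cast
  ring_nf
  try rw [hc]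
  try ring

lemma auxG_s16 {p R s : ℝ} (hp : 0 < p) (hR : 0 < R) (hs : 0 < s) :
    0 ≤ auxF p s - auxF p R + auxD p R * (Real.cosh s - Real.cosh R) := by
  set G : ℝ → ℝ := fun x => auxF p x + auxD p R * Real.cosh x with hG
  have hd : ∀ x, 0 < x → HasDerivAt G (Real.sinh x * (auxD p R - auxD p x)) x := by
    intro x hx
    have := (auxF_deriv (p := p) hx).add ((Real.hasDerivAt_cosh x).const_mul (auxD p R))
    refine HasDerivAt.congr_deriv (f := G) this ?_
    ring
  have key : G R ≤ G s := by
    rcases le_total R s with h | h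
    · have : MonotoneOn G (Set.Icc R s) := by
        apply monotoneOn_of_deriv_nonneg (convex_Icc _ _)
        · intro x hx
          exact (hd x (hR.trans_le hx.1)).continuousAt.continuousWithinAt
        · intro x hx
          rw [interior_Icc] at hx
          exact (hd x (hR.trans hx.1)).differentiableAt.differentiableWithinAt
        · intro x hx
          rw [interior_Icc] at hx
          rw [(hd x (hR.trans hx.1)).deriv]
          exact mul_nonneg (Real.sinh_nonneg_iff.2 (hR.trans hx.1).le)
            (sub_nonneg.2 (auxD_anti hp hR hx.1.le))
      exact this ⟨le_rfl, h⟩ ⟨h, le_rfl⟩ h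
    · have : AntitoneOn G (Set.Icc s R) := by
        apply antitoneOn_of_deriv_nonpos (convex_Icc _ _)
        · intro x hx
          exact (hd x (hs.trans_le hx.1)).continuousAt.continuousWithinAt
        · intro x hx
          rw [interior_Icc] at hx
          exact (hd x (hs.trans hx.1)).differentiableAt.differentiableWithinAt
        · intro x hx
          rw [interior_Icc] at hx
          rw [(hd x (hs.trans hx.1)).deriv]
          exact mul_nonpos_of_nonneg_of_nonpos (Real.sinh_nonneg_iff.2 (hs.trans hx.1).le)
            (sub_nonpos.2 (auxD_anti hp (hs.trans hx.1) hx.2.le))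
      exact this ⟨le_rfl, h⟩ ⟨h, le_rfl⟩ h
  simp only [hG] at key
  linarith

/-- Lemma 6.1, inequality (6.3): for `α, R₀ > 0` and `t > 1/cosh R₀`,
`(arcosh(t cosh R₀))^{−2α−1} t cosh R₀/(t² cosh² R₀ − 1)^{3/2} − R₀^{−2α−1} cosh R₀/sinh³ R₀
  ≥ −R₀^{−2α} ((2α+1)𝓗(R₀) − R₀² + 3𝓗(R₀)²) 𝓗(R₀) (t − 1)/(R₀⁴ sinh² R₀)`. -/
theorem arcosh_ineq_three (α R₀ : ℝ) (hα : 0 < α) (hR₀ : 0 < R₀) :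
    ∀ t : ℝ, 1 / Real.cosh R₀ < t →
      arcosh (t * Real.cosh R₀) ^ (-(2 * α) - 1) * (t * Real.cosh R₀) /
            (t ^ 2 * Real.cosh R₀ ^ 2 - 1) ^ ((3 : ℝ) / 2) -
          R₀ ^ (-(2 * α) - 1) * Real.cosh R₀ / Real.sinh R₀ ^ 3 ≥
        -(R₀ ^ (-(2 * α))) * ((2 * α + 1) * Hfun R₀ - R₀ ^ 2 + 3 * Hfun R₀ ^ 2) *
          Hfun R₀ * (t - 1) / (R₀ ^ 4 * Real.sinh R₀ ^ 2) := by
  intro t ht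
  have hc : 0 < Real.cosh R₀ := Real.cosh_pos R₀
  have hS : 0 < Real.sinh R₀ := Real.sinh_pos_iff.2 hR₀
  have hx : 1 < t * Real.cosh R₀ := by rwa [div_lt_iff₀ hc] at ht
  have hs : 0 < arcosh (t * Real.cosh R₀) := Real.arcosh_pos hx
  have hcs : Real.cosh (arcosh (t * Real.cosh R₀)) = t * Real.cosh R₀ := Real.cosh_arcosh hx.le
  have hmain := auxG_s16 (p := 2 * α + 1) (by linarith) hR₀ hs
  have hT : (t ^ 2 * Real.cosh R₀ ^ 2 - 1) ^ ((3 : ℝ) / 2)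
      = Real.sinh (arcosh (t * Real.cosh R₀)) ^ 3 := by
    have h0 : 0 ≤ Real.sinh (arcosh (t * Real.cosh R₀)) := Real.sinh_nonneg_iff.2 hs.le
    have : t ^ 2 * Real.cosh R₀ ^ 2 - 1 = Real.sinh (arcosh (t * Real.cosh R₀)) ^ (2 : ℝ) := by
      rw [Real.rpow_two, Real.sinh_sq, hcs]; ring
    rw [this, ← Real.rpow_mul h0, ← Real.rpow_natCast]
    norm_num
  rw [hT]
  have e : -(2 * α) - 1 = -(2 * α + 1) := by ring
  rw [e]
  have e2 : R₀ ^ (-(2 * α)) = R₀ ^ (-(2 * α + 1)) * R₀ := by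
    rw [← e, Real.rpow_sub_one hR₀.ne']; field_simp
  rw [e2]
  have e3 : -(R₀ ^ (-(2 * α + 1)) * R₀) * ((2 * α + 1) * Hfun R₀ - R₀ ^ 2 + 3 * Hfun R₀ ^ 2) *
          Hfun R₀ * (t - 1) / (R₀ ^ 4 * Real.sinh R₀ ^ 2)
      = - (auxD (2 * α + 1) R₀ * (t * Real.cosh R₀ - Real.cosh R₀)) := by
    have hcc : Real.cosh R₀ ^ 2 = Real.sinh R₀ ^ 2 + 1 := Real.cosh_sq R₀
    have e4 : (2 * α + 1) * Hfun R₀ - R₀ ^ 2 + 3 * Hfun R₀ ^ 2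
        = (2 * α + 1) * (R₀ * Real.cosh R₀ / Real.sinh R₀) + 2 * R₀ ^ 2
          + 3 * R₀ ^ 2 / Real.sinh R₀ ^ 2 := by
      unfold Hfun
      field_simp
      rw [hcc]
      ring
    rw [e4]
    unfold auxD Hfun
    field_simp
    try ring
  rw [e3]
  rw [hcs] at hmain
  unfold auxF at hmain
  rw [hcs] at hmain
  have e5 := mul_div_assoc (arcosh (t * Real.cosh R₀) ^ (-(2 * α + 1))) (t * Real.cosh R₀)
    (Real.sinh (arcosh (t * Real.cosh R₀)) ^ 3)
  have e6 := mul_div_assoc (R₀ ^ (-(2 * α + 1))) (Real.cosh R₀) (Real.sinh R₀ ^ 3)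
  rw [e5, e6]
  linarith
end
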